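/- arXiv:1201.5361 — 2 statements merged into one kernel-verified Lean document; each statement's English description precedes it below -/
import Mathlib

section
/- Every proper subgraph of K_2 + H_7 is 5-colorable (so K_2 + H_7 is 6-critical). -/
open SimpleGraph

/-- The join `K + L` of two graphs: disjoint union plus all cross edges. -/
def graphJoin {V W : Type*} (G : SimpleGraph V) (H : SimpleGraph W) :
    SimpleGraph (V ⊕ W) :=
  SimpleGraph.fromRel fun x y =>
    match x, y with
    | Sum.inl a, Sum.inl b => G.Adj a b
    | Sum.inr a, Sum.inr b => H.Adj a b
    | Sum.inl _, Sum.inr _ => True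
    | Sum.inr _, Sum.inl _ => False

/-- The cycle `C_n` on `n` vertices (vertex set `ZMod n`, `i ~ j` iff `i - j = ±1`). -/
def cyc (n : ℕ) : SimpleGraph (ZMod n) :=
  SimpleGraph.fromRel fun i j => i - j = 1

/-- The Moser spindle `H_7`: vertices `0 = z, 1 = a1, 2 = a2, 3 = b, 4 = c1, 5 = c2, 6 = d`. -/
def H7 : SimpleGraph (Fin 7) :=
  SimpleGraph.fromRel fun i j => (i.val, j.val) ∈
    [(0,1), (0,2), (1,2), (1,3), (2,3), (0,4), (0,5), (4,5), (4,6), (5,6), (3,6)]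

/-- `M_7`: vertices `0..5 = x1..x6` on a 6-cycle with chords `x1x3, x3x5, x5x1`,
and `6 = v` joined to `x2, x4, x6`. -/
def M7 : SimpleGraph (Fin 7) :=
  SimpleGraph.fromRel fun i j => (i.val, j.val) ∈
    [(0,1), (1,2), (2,3), (3,4), (4,5), (5,0), (0,2), (2,4), (4,0), (6,1), (6,3), (6,5)]

/-- `T_11`: the graph on `ZMod 11` where distinct `i, j` are adjacent iff
`i - j ≡ ±1, ±2, ±3 (mod 11)`. -/
def T11 : SimpleGraph (ZMod 11) :=
  SimpleGraph.fromRel fun i j => i - j = 1 ∨ i - j = 2 ∨ i - j = 3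

/-- The coloring `c` of `G` is proper except possibly at the edge `e`. -/
def IsProperOff {V α : Type*} (G : SimpleGraph V) (e : Sym2 V) (c : V → α) : Prop :=
  ∀ ⦃x y⦄, G.Adj x y → c x = c y → s(x, y) = e

theorem graphJoin_adj_inl_inl {V W : Type*} {G : SimpleGraph V} {H : SimpleGraph W} {a b : V} :
    (graphJoin G H).Adj (.inl a) (.inl b) ↔ G.Adj a b := by
  simp only [graphJoin, fromRel_adj, ne_eq, Sum.inl.injEq, G.adj_comm b a, or_self]
  exact and_iff_right_of_imp fun h => h.ne

theorem graphJoin_adj_inr_inr {V W : Type*} {G : SimpleGraph V} {H : SimpleGraph W} {a b : W} :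
    (graphJoin G H).Adj (.inr a) (.inr b) ↔ H.Adj a b := by
  simp only [graphJoin, fromRel_adj, ne_eq, Sum.inr.injEq, H.adj_comm b a, or_self]
  exact and_iff_right_of_imp fun h => h.ne

theorem graphJoin_adj_inl_inr {V W : Type*} (G : SimpleGraph V) (H : SimpleGraph W)
    (a : V) (b : W) : (graphJoin G H).Adj (.inl a) (.inr b) := by
  simp [graphJoin]

/-- In a graph without isolated vertices, a subgraph containing all edges is the whole graph. -/
theorem SimpleGraph.Subgraph.exists_adj_not_adj_of_ne_top {V : Type*} {G : SimpleGraph V}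
    (hG : ∀ v, ∃ w, G.Adj v w) {H : G.Subgraph} (hH : H ≠ ⊤) :
    ∃ u v, G.Adj u v ∧ ¬ H.Adj u v := by
  by_contra! h
  refine hH (top_le_iff.mp ⟨fun v _ => ?_, fun u v huv => h u v huv⟩)
  obtain ⟨w, hw⟩ := hG v
  exact H.edge_vert (h v w hw)

/-- If every edge is the only obstruction to some coloring of `G`, then every proper subgraph of
`G` is colorable. -/
theorem colorable_coe_of_isProperOff {V α : Type*} [Fintype α] {G : SimpleGraph V}
    (hG : ∀ v, ∃ w, G.Adj v w)
    (hc : ∀ u v, G.Adj u v → ∃ c : V → α, IsProperOff G s(u, v) c)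
    {H : G.Subgraph} (hH : H ≠ ⊤) : H.coe.Colorable (Fintype.card α) := by
  obtain ⟨u, v, huv, hn⟩ := Subgraph.exists_adj_not_adj_of_ne_top hG hH
  obtain ⟨c, hc⟩ := hc u v huv
  suffices C : H.coe.Coloring α from C.colorable
  refine Coloring.mk (fun x => c x) fun {x y} hxy heq => hn ?_
  have he := hc (H.adj_sub hxy) heq
  rw [← Subgraph.mem_edgeSet, ← he]
  exact hxy

/-- Joining with a complete graph preserves edge-criticality. -/
theorem exists_isProperOff_graphJoin_top {V W α : Type*} {H : SimpleGraph W} [Nonempty W]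
    (hH : ∀ v, ∃ w, H.Adj v w)
    (hc : ∀ u v, H.Adj u v → ∃ c : W → α, IsProperOff H s(u, v) c)
    (p q : V ⊕ W) (hpq : (graphJoin (⊤ : SimpleGraph V) H).Adj p q) :
    ∃ c : V ⊕ W → V ⊕ α, IsProperOff (graphJoin (⊤ : SimpleGraph V) H) s(p, q) c := by
  classical
  have cross : ∀ (a : V) (w : W), ∃ c : V ⊕ W → V ⊕ α,
      IsProperOff (graphJoin (⊤ : SimpleGraph V) H) s(.inl a, .inr w) c := by
    intro a w
    obtain ⟨w', hw'⟩ := hH w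
    obtain ⟨c, hc⟩ := hc w w' hw'
    refine ⟨Sum.elim .inl fun x => if x = w then .inl a else .inr (c x), ?_⟩
    rintro (x | x) (y | y) hxy he <;>
      try simp only [graphJoin_adj_inl_inl, graphJoin_adj_inr_inr, top_adj] at hxy
    all_goals simp only [Sum.elim_inl, Sum.elim_inr] at he
    · grind
    · grind
    · grind
    · have := @hc x y hxy
      have := hxy.ne
      grind
  rcases p with a | u <;> rcases q with b | v
  · obtain ⟨w⟩ := ‹Nonempty W›
    obtain ⟨w', hw'⟩ := hH w
    obtain ⟨c, hc⟩ := hc w w' hw'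
    rw [graphJoin_adj_inl_inl, top_adj] at hpq
    refine ⟨Sum.elim (fun x => .inl (if x = b then a else x))
      fun x => if x = w then .inl b else .inr (c x), ?_⟩
    rintro (x | x) (y | y) hxy he <;>
      try simp only [graphJoin_adj_inl_inl, graphJoin_adj_inr_inr, top_adj] at hxy
    all_goals simp only [Sum.elim_inl, Sum.elim_inr] at he
    · grind
    · grind
    · grind
    · have := @hc x y hxy
      have := hxy.ne
      grind
  · exact cross a v
  · rw [Sym2.eq_swap]
    exact cross b u
  · rw [graphJoin_adj_inr_inr] at hpq
    obtain ⟨c, hc⟩ := hc u v hpq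
    refine ⟨Sum.map id c, ?_⟩
    rintro (x | x) (y | y) hxy he <;>
      try simp only [graphJoin_adj_inl_inl, graphJoin_adj_inr_inr, top_adj] at hxy
    all_goals simp only [Sum.map_inl, Sum.map_inr, id, reduceCtorEq, Sum.inl.injEq,
      Sum.inr.injEq] at he
    · exact absurd he hxy
    · have := hc hxy he
      grind

instance : DecidableRel H7.Adj := by
  unfold H7
  infer_instance

theorem H7_exists_adj : ∀ v, ∃ w, H7.Adj v w := by
  decide

instance (e : Sym2 (Fin 7)) (c : Fin 7 → Fin 3) : Decidable (IsProperOff H7 e c) := by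
  unfold IsProperOff
  infer_instance

/-- The Moser spindle is edge-critical: removing any edge makes it 3-colorable. -/
theorem H7_exists_isProperOff (u v : Fin 7) (huv : H7.Adj u v) :
    ∃ c : Fin 7 → Fin 3, IsProperOff H7 s(u, v) c := by
  have key : ∀ u v, H7.Adj u v → ∃ c ∈ ([
      ![0, 0, 1, 2, 1, 2, 0], ![0, 1, 0, 2, 1, 2, 0], ![0, 1, 1, 2, 1, 2, 0],
      ![0, 1, 2, 1, 1, 2, 0], ![0, 1, 2, 2, 1, 2, 0], ![0, 1, 2, 0, 0, 1, 2],
      ![0, 1, 2, 0, 1, 0, 2], ![0, 1, 2, 0, 1, 1, 2], ![0, 1, 2, 0, 1, 2, 1],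
      ![0, 1, 2, 0, 1, 2, 2], ![0, 1, 2, 0, 1, 2, 0]] : List (Fin 7 → Fin 3)),
      IsProperOff H7 s(u, v) c := by
    decide +kernel
  obtain ⟨c, -, hc⟩ := key u v huv
  exact ⟨c, hc⟩

/-- Every proper subgraph of `K_2 + H_7` is 5-colorable (so `K_2 + H_7` is 6-critical). -/
theorem k2_join_h7_proper_subgraphs_five_colorable :
    ∀ H : (graphJoin (⊤ : SimpleGraph (Fin 2)) H7).Subgraph, H ≠ ⊤ → H.coe.Colorable 5 := by
  intro H hH
  refine colorable_coe_of_isProperOff (α := Fin 2 ⊕ Fin 3) ?_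
    (exists_isProperOff_graphJoin_top H7_exists_adj H7_exists_isProperOff) hH
  rintro (a | w)
  · exact ⟨_, graphJoin_adj_inl_inr _ _ a 0⟩
  · exact ⟨_, (graphJoin_adj_inl_inr _ _ 0 w).symm⟩
end

section
/- Every 4-critical graph with at most seven vertices is isomorphic to K_4, K_1 + C_5, H_7, or M_7. -/
open SimpleGraph

/-- A graph is `t`-critical if it is not `(t-1)`-colorable but every proper subgraph is
`(t-1)`-colorable. -/
def IsCritical (t : ℕ) {V : Type*} (G : SimpleGraph V) : Prop :=
  ¬ G.Colorable (t - 1) ∧ ∀ H : G.Subgraph, H ≠ ⊤ → H.coe.Colorable (t - 1)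


/-- The bitmask of the pair `{i, j}` of `Fin 7` coded as `e = 7 * i + j`. It contains both codes
`7 * i + j` and `7 * j + i`. -/
def pairMask (e : ℕ) : ℕ :=
  Nat.lor (Nat.shiftLeft 1 e) (Nat.shiftLeft 1 (7 * (e % 7) + e / 7 % 7))

/-- The pairs of `Fin 7`, coded as `7 * i + j` with `i < j`, whose ends lie in different classes
of `p`. -/
def crossPairs (p : Fin 7 → Fin 4) : List ℕ :=
  (List.range 49).filter fun e =>
    decide (e / 7 < e % 7) && decide (p (Fin.ofNat 7 (e / 7)) ≠ p (Fin.ofNat 7 (e % 7)))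

/-- The pairs of `E` that are monochromatic in the coloring given by the base `3` digits of `k`. -/
def monoPairs (E : List ℕ) (k : ℕ) : List ℕ :=
  E.filter fun e => (k / 3 ^ (e / 7) % 3).beq (k / 3 ^ (e % 7) % 3)

/-- The sets of monochromatic pairs in `E`, with their bitmasks, of the colorings that use color `0`
on vertex `6` and color `1` on vertex `5`. Only sets disjoint from `P` are listed, small ones
first. -/
def monoClauses (E : List ℕ) (P : ℕ) : List (ℕ × List ℕ) :=
  let l := ((List.range 243).map fun k =>
      let c := monoPairs E (243 + k)
      (c.foldr (fun e m => Nat.lor (pairMask e) m) 0, c)).filter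
    fun c => (Nat.land c.1 P).beq 0
  (List.range 7).flatMap fun s => l.filter fun c => c.2.length.beq s

/-- Run `f` on `P` extended by each pair of a clause outside `X`, adding the earlier pairs
to `X`. -/
def branchOn (f : ℕ → ℕ → Bool) : List ℕ → ℕ → ℕ → Bool
  | [], _, _ => true
  | e :: es, P, X =>
    bif X.testBit e then branchOn f es P X
    else f (Nat.lor P (pairMask e)) X && branchOn f es P (Nat.lor X (pairMask e))

/-- Check that every edge set containing `P`, disjoint from `X` and meeting all clauses contains a
set accepted by `leaf`. -/
def checkTransversals (leaf : ℕ → Bool) : List (ℕ × List ℕ) → ℕ → ℕ → Bool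
  | [], P, _ => leaf P
  | c :: cs, P, X =>
    bif (Nat.land c.1 P).beq 0 then branchOn (checkTransversals leaf cs) c.2 P X
    else checkTransversals leaf cs P X

/-- Whether `f` holds at some `w < 7` whose bit is set in `m`. -/
def anyBit (m : ℕ) (f : ℕ → Bool) : Bool :=
  bif m.beq 0 then false else [0, 1, 2, 3, 4, 5, 6].any fun w => m.testBit w && f w

/-- The bitmask of the neighbors of `a`, for the edge set `P`. -/
def nbrs (P a : ℕ) : ℕ := Nat.land (Nat.shiftRight P (Nat.mul 7 a)) 127

/-- The bitmask of the neighbors of `a` that are larger than `a`. -/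
def upper (P a : ℕ) : ℕ := Nat.land (nbrs P a) (Nat.shiftLeft 254 a)

/-- Whether the graph with edge set `P` contains `K_4`. -/
def hasK4 (P : ℕ) : Bool :=
  anyBit 127 fun a => anyBit (upper P a) fun b =>
  anyBit (Nat.land (upper P a) (upper P b)) fun c =>
  anyBit (Nat.land (Nat.land (upper P a) (upper P b)) (upper P c)) fun _ => true

/-- Whether the graph with edge set `P` contains `K_1 + C_5`. -/
def hasW5 (P : ℕ) : Bool :=
  anyBit 127 fun h => anyBit (nbrs P h) fun a =>
  anyBit (Nat.land (nbrs P h) (upper P a)) fun b =>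
  anyBit (Nat.land (nbrs P h) (nbrs P b)) fun c => !(c.beq a) &&
  anyBit (Nat.land (nbrs P h) (nbrs P c)) fun d => !(d.beq a) && !(d.beq b) &&
  anyBit (Nat.land (Nat.land (nbrs P h) (nbrs P d)) (upper P a)) fun e =>
    !(e.beq b) && !(e.beq c)

/-- Whether the graph with edge set `P` contains `H_7`. -/
def hasH7 (P : ℕ) : Bool :=
  anyBit 127 fun z => anyBit (nbrs P z) fun a₁ =>
  anyBit (Nat.land (nbrs P z) (upper P a₁)) fun a₂ =>
  anyBit (Nat.land (nbrs P a₁) (nbrs P a₂)) fun b => !(b.beq z) &&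
  anyBit (nbrs P z) fun c₁ => !(c₁.beq a₁) && !(c₁.beq a₂) && !(c₁.beq b) &&
  anyBit (Nat.land (nbrs P z) (upper P c₁)) fun c₂ =>
    !(c₂.beq a₁) && !(c₂.beq a₂) && !(c₂.beq b) &&
  anyBit (Nat.land (Nat.land (nbrs P c₁) (nbrs P c₂)) (nbrs P b)) fun d =>
    !(d.beq z) && !(d.beq a₁) && !(d.beq a₂)

/-- Whether the graph with edge set `P` contains `M_7`. -/
def hasM7 (P : ℕ) : Bool :=
  anyBit 127 fun x₁ => anyBit (upper P x₁) fun x₃ =>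
  anyBit (Nat.land (upper P x₁) (upper P x₃)) fun x₅ =>
  anyBit (Nat.land (nbrs P x₁) (nbrs P x₃)) fun x₂ => !(x₂.beq x₅) &&
  anyBit (Nat.land (nbrs P x₃) (nbrs P x₅)) fun x₄ => !(x₄.beq x₁) && !(x₄.beq x₂) &&
  anyBit (Nat.land (nbrs P x₅) (nbrs P x₁)) fun x₆ =>
    !(x₆.beq x₂) && !(x₆.beq x₃) && !(x₆.beq x₄) &&
  anyBit (Nat.land (Nat.land (nbrs P x₂) (nbrs P x₄)) (nbrs P x₆)) fun v =>
    !(v.beq x₁) && !(v.beq x₃) && !(v.beq x₅)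

/-- Whether the graph with edge set `P` contains one of the four critical graphs. -/
def hasCritical (P : ℕ) : Bool := hasK4 P || hasW5 P || hasH7 P || hasM7 P

/-- Check that every graph with edges `P` whose edges join different classes of `p` and that is not
`3`-colorable contains one of the four critical graphs. -/
def checkPattern (p : Fin 7 → Fin 4) (P : ℕ) : Bool :=
  checkTransversals hasCritical (monoClauses (crossPairs p) P) P 0

/-- The edges joining vertex `6` to the last vertices of the classes of a partition. -/
def star (a b c : ℕ) : ℕ :=
  Nat.lor (pairMask (7 * a + 6)) (Nat.lor (pairMask (7 * b + 6)) (pairMask (7 * c + 6)))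

theorem checkPattern_222 : checkPattern ![2, 2, 1, 1, 0, 0, 3] (star 5 3 1) = true := by
  decide +kernel

theorem checkPattern_123 : checkPattern ![2, 2, 2, 1, 1, 0, 3] (star 5 4 2) = true := by
  decide +kernel

theorem checkPattern_114 : checkPattern ![2, 2, 2, 2, 1, 0, 3] (star 5 4 3) = true := by
  decide +kernel

/-- The set of codes of the (ordered) edges of a graph on `Fin 7`. -/
def codes (G : SimpleGraph (Fin 7)) : Set ℕ :=
  {e | G.Adj (Fin.ofNat 7 (e / 7)) (Fin.ofNat 7 (e % 7))}

theorem codes_of_pairMask {G : SimpleGraph (Fin 7)} {e i : ℕ} (h : (pairMask e).testBit i = true) :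
    i ∈ codes G ↔ e ∈ codes G := by
  have h' : i = e ∨ i = 7 * (e % 7) + e / 7 % 7 := by
    have h' : (1 <<< e ||| 1 <<< (7 * (e % 7) + e / 7 % 7)).testBit i = true := h
    rw [Nat.testBit_or, Nat.one_shiftLeft, Nat.one_shiftLeft, Nat.testBit_two_pow,
      Nat.testBit_two_pow, Bool.or_eq_true, decide_eq_true_eq, decide_eq_true_eq] at h'
    exact h'.imp Eq.symm Eq.symm
  obtain rfl | rfl := h'
  · rfl
  · have h₁ : (7 * (e % 7) + e / 7 % 7) / 7 = e % 7 := by omega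
    have h₂ : (7 * (e % 7) + e / 7 % 7) % 7 = e / 7 % 7 := by omega
    have h₃ : Fin.ofNat 7 (e / 7 % 7) = Fin.ofNat 7 (e / 7) := by ext; simp
    simp only [codes, Set.mem_ofPred_eq, h₁, h₂, h₃]
    exact G.adj_comm _ _

theorem testBit_lor_pairMask {G : SimpleGraph (Fin 7)} {P e i : ℕ}
    (h : (Nat.lor P (pairMask e)).testBit i = true) :
    P.testBit i = true ∨ (i ∈ codes G ↔ e ∈ codes G) := by
  have h' : (P ||| pairMask e).testBit i = true := h
  rw [Nat.testBit_or, Bool.or_eq_true] at h'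
  exact h'.imp_right codes_of_pairMask

theorem exists_of_branchOn {G : SimpleGraph (Fin 7)} {f : ℕ → ℕ → Bool} {p : ℕ → Prop}
    (hf : ∀ P X, f P X = true → (∀ i, P.testBit i = true → i ∈ codes G) →
      (∀ i, X.testBit i = true → i ∉ codes G) → ∃ Q, p Q ∧ ∀ i, Q.testBit i = true → i ∈ codes G)
    {c : List ℕ} {P X : ℕ} (h : branchOn f c P X = true)
    (hP : ∀ i, P.testBit i = true → i ∈ codes G) (hX : ∀ i, X.testBit i = true → i ∉ codes G)
    (hc : ∃ e ∈ c, e ∈ codes G) : ∃ Q, p Q ∧ ∀ i, Q.testBit i = true → i ∈ codes G := by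
  induction c generalizing X with
  | nil => simp at hc
  | cons e es ih =>
    rw [branchOn] at h
    have hes : e ∉ codes G → ∃ e ∈ es, e ∈ codes G := fun he => by
      obtain ⟨a, ha, haG⟩ := hc
      obtain rfl | ha := List.mem_cons.1 ha
      · exact absurd haG he
      · exact ⟨a, ha, haG⟩
    cases hXe : X.testBit e with
    | true =>
      rw [hXe] at h
      exact ih h hX (hes (hX e hXe))
    | false =>
      rw [hXe, cond_false, Bool.and_eq_true] at h
      by_cases he : e ∈ codes G
      · refine hf _ _ h.1 (fun i hi => ?_) hX
        exact (testBit_lor_pairMask hi).elim (hP i) fun h => h.2 he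
      · refine ih h.2 (fun i hi => ?_) (hes he)
        exact (testBit_lor_pairMask hi).elim (hX i) fun h h' => he (h.1 h')

theorem exists_of_checkTransversals {G : SimpleGraph (Fin 7)} {leaf : ℕ → Bool}
    {cs : List (ℕ × List ℕ)} {P X : ℕ} (h : checkTransversals leaf cs P X = true)
    (hP : ∀ i, P.testBit i = true → i ∈ codes G) (hX : ∀ i, X.testBit i = true → i ∉ codes G)
    (hcs : ∀ c ∈ cs, ∃ e ∈ c.2, e ∈ codes G) :
    ∃ Q, leaf Q = true ∧ ∀ i, Q.testBit i = true → i ∈ codes G := by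
  induction cs generalizing P X with
  | nil => exact ⟨P, h, hP⟩
  | cons c cs ih =>
    rw [List.forall_mem_cons] at hcs
    rw [checkTransversals] at h
    cases hcP : (Nat.land c.1 P).beq 0 with
    | true =>
      rw [hcP] at h
      exact exists_of_branchOn (fun P X h hP hX => ih h hP hX hcs.2) h hP hX hcs.1
    | false =>
      rw [hcP] at h
      exact ih h hP hX hcs.2

theorem exists_mem_monoPairs {G : SimpleGraph (Fin 7)} {p : Fin 7 → Fin 4}
    (hp : ∀ i j, G.Adj i j → p i ≠ p j) (hG : ¬ G.Colorable 3) (k : ℕ) :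
    ∃ e ∈ monoPairs (crossPairs p) k, e ∈ codes G := by
  by_contra! hk
  refine hG ⟨Coloring.mk (fun i => Fin.ofNat 3 (k / 3 ^ (i : ℕ))) ?_⟩
  have key : ∀ i j : Fin 7, i < j → G.Adj i j →
      Fin.ofNat 3 (k / 3 ^ (i : ℕ)) ≠ Fin.ofNat 3 (k / 3 ^ (j : ℕ)) := by
    intro i j hij hadj heq
    have h₁ : (7 * (i : ℕ) + j) / 7 = i := by omega
    have h₂ : (7 * (i : ℕ) + j) % 7 = j := by omega
    have h₃ (i : Fin 7) : Fin.ofNat 7 (i : ℕ) = i := by simp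
    refine hk (7 * i + j) ?_ (by simpa only [codes, Set.mem_ofPred_eq, h₁, h₂, h₃])
    simp only [monoPairs, crossPairs, List.mem_filter, List.mem_range, h₁, h₂, h₃,
      Bool.and_eq_true, decide_eq_true_eq, Nat.beq_eq]
    exact ⟨⟨by omega, hij, hp i j hadj⟩, congrArg Fin.val heq⟩
  intro i j hadj
  obtain h | h := hadj.ne.lt_or_gt
  · exact key i j h hadj
  · exact (key j i h hadj.symm).symm

theorem anyBit_eq_true {m : ℕ} {f : ℕ → Bool} (h : anyBit m f = true) :
    ∃ w : Fin 7, m.testBit w = true ∧ f w = true := by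
  rw [anyBit] at h
  cases hm : m.beq 0 with
  | true => simp [hm] at h
  | false =>
    rw [hm, cond_false, List.any_eq_true] at h
    obtain ⟨w, hw, h⟩ := h
    have hw7 : w < 7 := by
      simp at hw
      omega
    exact ⟨⟨w, hw7⟩, by simpa using h⟩

section Copies

variable {G : SimpleGraph (Fin 7)} {P : ℕ}

theorem adj_of_nbrs (hP : ∀ i, P.testBit i = true → i ∈ codes G) {a b : Fin 7}
    (h : (nbrs P a).testBit b = true) : G.Adj a b := by
  have h' : ((P >>> (7 * (a : ℕ))) &&& 127).testBit b = true := h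
  rw [Nat.testBit_and, Nat.testBit_shiftRight, Bool.and_eq_true] at h'
  have h₁ : (7 * (a : ℕ) + b) / 7 = a := by omega
  have h₂ : (7 * (a : ℕ) + b) % 7 = b := by omega
  simpa [codes, h₁, h₂] using hP _ h'.1

theorem testBit_land {m n i : ℕ} (h : (Nat.land m n).testBit i = true) :
    m.testBit i = true ∧ n.testBit i = true := by
  have h' : (m &&& n).testBit i = true := h
  simpa using h'

theorem adj_of_upper (hP : ∀ i, P.testBit i = true → i ∈ codes G) {a b : Fin 7}
    (h : (upper P a).testBit b = true) : G.Adj a b :=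
  adj_of_nbrs hP (testBit_land h).1

theorem ne_of_not_beq {a b : Fin 7} (h : (!(a : ℕ).beq b) = true) : a ≠ b := by
  rintro rfl
  simp at h

/-- A graph given by a relation is contained in `G` if the relation is mapped into adjacency by an
injective map. -/
theorem isContained_fromRel {α β : Type*} {G : SimpleGraph β} {r : α → α → Prop} {φ : α → β}
    (hφ : Function.Injective φ) (h : ∀ i j, r i j → G.Adj (φ i) (φ j)) :
    (SimpleGraph.fromRel r).IsContained G := by
  refine ⟨⟨⟨φ, ?_⟩, hφ⟩⟩
  rintro i j ⟨-, hij | hij⟩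
  · exact h i j hij
  · exact (h j i hij).symm

theorem isContained_of_hasK4 (hP : ∀ i, P.testBit i = true → i ∈ codes G) (h : hasK4 P = true) :
    (⊤ : SimpleGraph (Fin 4)).IsContained G := by
  obtain ⟨a, -, h⟩ := anyBit_eq_true h
  obtain ⟨b, hab, h⟩ := anyBit_eq_true h
  obtain ⟨c, hc, h⟩ := anyBit_eq_true h
  obtain ⟨d, hd, -⟩ := anyBit_eq_true h
  have hab := adj_of_upper hP hab
  have hac := adj_of_upper hP (testBit_land hc).1
  have hbc := adj_of_upper hP (testBit_land hc).2
  have had := adj_of_upper hP (testBit_land (testBit_land hd).1).1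
  have hbd := adj_of_upper hP (testBit_land (testBit_land hd).1).2
  have hcd := adj_of_upper hP (testBit_land hd).2
  have key : ∀ i j : Fin 4, i ≠ j → G.Adj (![a, b, c, d] i) (![a, b, c, d] j) := by
    intro i j hij
    fin_cases i <;> fin_cases j <;> simp_all [G.adj_comm]
  refine ⟨⟨⟨![a, b, c, d], fun {i j} hij => key i j hij⟩, fun i j hij => ?_⟩⟩
  by_contra hne
  exact (key i j hne).ne hij

theorem isContained_of_hasW5 (hP : ∀ i, P.testBit i = true → i ∈ codes G) (h : hasW5 P = true) :
    (graphJoin (⊤ : SimpleGraph (Fin 1)) (cyc 5)).IsContained G := by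
  obtain ⟨z, -, h⟩ := anyBit_eq_true h
  obtain ⟨a, hza, h⟩ := anyBit_eq_true h
  obtain ⟨b, hb, h⟩ := anyBit_eq_true h
  obtain ⟨c, hc, h⟩ := anyBit_eq_true h
  simp only [Bool.and_eq_true] at h
  obtain ⟨hca, h⟩ := h
  obtain ⟨d, hd, h⟩ := anyBit_eq_true h
  simp only [Bool.and_eq_true] at h
  obtain ⟨⟨hda, hdb⟩, h⟩ := h
  obtain ⟨e, he, h⟩ := anyBit_eq_true h
  simp only [Bool.and_eq_true] at h
  have hca := ne_of_not_beq hca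
  have hda := ne_of_not_beq hda
  have hdb := ne_of_not_beq hdb
  have heb := ne_of_not_beq h.1
  have hec := ne_of_not_beq h.2
  have hza := adj_of_nbrs hP hza
  have hzb := adj_of_nbrs hP (testBit_land hb).1
  have hab := adj_of_upper hP (testBit_land hb).2
  have hzc := adj_of_nbrs hP (testBit_land hc).1
  have hbc := adj_of_nbrs hP (testBit_land hc).2
  have hzd := adj_of_nbrs hP (testBit_land hd).1
  have hcd := adj_of_nbrs hP (testBit_land hd).2
  have hze := adj_of_nbrs hP (testBit_land (testBit_land he).1).1
  have hde := adj_of_nbrs hP (testBit_land (testBit_land he).1).2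
  have hae := adj_of_upper hP (testBit_land he).2
  have hcyc : ∀ i j : Fin 5, i - j = 1 → G.Adj (![a, b, c, d, e] i) (![a, b, c, d, e] j) := by
    intro i j hij
    have hi : i = j + 1 := by rw [← hij, add_comm, sub_add_cancel]
    subst hi
    fin_cases j <;> simp [hab.symm, hbc.symm, hcd.symm, hde.symm, hae]
  have hz : ∀ i : Fin 5, G.Adj z (![a, b, c, d, e] i) := by
    intro i
    fin_cases i <;> assumption
  have hinj : Function.Injective ![a, b, c, d, e] := by
    rw [← List.nodup_ofFn]
    simp [hab.ne, hae.ne, hbc.ne, hcd.ne, hde.ne, hca.symm, hda.symm, hdb.symm, heb.symm, hec.symm]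
  refine isContained_fromRel (φ := Sum.elim (fun _ => z) ![a, b, c, d, e]) ?_ ?_
  · refine Function.Injective.sumElim (fun _ _ _ => Subsingleton.elim _ _) hinj ?_
    exact fun _ i => (hz i).ne
  · rintro (i | i) (j | j) hij
    · exact absurd (Subsingleton.elim i j) hij
    · exact hz j
    · exact hij.elim
    · obtain ⟨-, hij | hij⟩ := hij
      · exact hcyc i j hij
      · exact (hcyc j i hij).symm

theorem isContained_of_hasH7 (hP : ∀ i, P.testBit i = true → i ∈ codes G) (h : hasH7 P = true) :
    H7.IsContained G := by
  obtain ⟨z, -, h⟩ := anyBit_eq_true h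
  obtain ⟨a, hza, h⟩ := anyBit_eq_true h
  obtain ⟨a₂, ha₂, h⟩ := anyBit_eq_true h
  obtain ⟨b, hb, h⟩ := anyBit_eq_true h
  simp only [Bool.and_eq_true] at h
  obtain ⟨hbz, h⟩ := h
  obtain ⟨c, hzc, h⟩ := anyBit_eq_true h
  simp only [Bool.and_eq_true] at h
  obtain ⟨⟨⟨hca, hca₂⟩, hcb⟩, h⟩ := h
  obtain ⟨c₂, hc₂, h⟩ := anyBit_eq_true h
  simp only [Bool.and_eq_true] at h
  obtain ⟨⟨⟨hc₂a, hc₂a₂⟩, hc₂b⟩, h⟩ := h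
  obtain ⟨d, hd, h⟩ := anyBit_eq_true h
  simp only [Bool.and_eq_true] at h
  obtain ⟨⟨hdz, hda⟩, hda₂⟩ := h
  have hbz := ne_of_not_beq hbz
  have hca := ne_of_not_beq hca
  have hca₂ := ne_of_not_beq hca₂
  have hcb := ne_of_not_beq hcb
  have hc₂a := ne_of_not_beq hc₂a
  have hc₂a₂ := ne_of_not_beq hc₂a₂
  have hc₂b := ne_of_not_beq hc₂b
  have hdz := ne_of_not_beq hdz
  have hda := ne_of_not_beq hda
  have hda₂ := ne_of_not_beq hda₂
  have hza := adj_of_nbrs hP hza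
  have hza₂ := adj_of_nbrs hP (testBit_land ha₂).1
  have haa₂ := adj_of_upper hP (testBit_land ha₂).2
  have hab := adj_of_nbrs hP (testBit_land hb).1
  have ha₂b := adj_of_nbrs hP (testBit_land hb).2
  have hzc := adj_of_nbrs hP hzc
  have hzc₂ := adj_of_nbrs hP (testBit_land hc₂).1
  have hcc₂ := adj_of_upper hP (testBit_land hc₂).2
  have hcd := adj_of_nbrs hP (testBit_land (testBit_land hd).1).1
  have hc₂d := adj_of_nbrs hP (testBit_land (testBit_land hd).1).2
  have hbd := adj_of_nbrs hP (testBit_land hd).2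
  refine isContained_fromRel (φ := ![z, a, a₂, b, c, c₂, d]) ?_ fun i j hij => ?_
  · rw [← List.nodup_ofFn]
    simp [hza.ne, hza₂.ne, haa₂.ne, hab.ne, ha₂b.ne, hzc.ne, hzc₂.ne, hcc₂.ne, hcd.ne, hc₂d.ne,
      hbd.ne, hbz.symm, hca.symm, hca₂.symm, hcb.symm, hc₂a.symm, hc₂a₂.symm, hc₂b.symm, hdz.symm,
      hda.symm, hda₂.symm]
  · fin_cases i <;> fin_cases j <;> first | assumption | simp at hij

theorem isContained_of_hasM7 (hP : ∀ i, P.testBit i = true → i ∈ codes G) (h : hasM7 P = true) :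
    M7.IsContained G := by
  obtain ⟨x₁, -, h⟩ := anyBit_eq_true h
  obtain ⟨x₃, h₁₃, h⟩ := anyBit_eq_true h
  obtain ⟨x₅, h₅, h⟩ := anyBit_eq_true h
  obtain ⟨x₂, h₂, h⟩ := anyBit_eq_true h
  simp only [Bool.and_eq_true] at h
  obtain ⟨n₂₅, h⟩ := h
  obtain ⟨x₄, h₄, h⟩ := anyBit_eq_true h
  simp only [Bool.and_eq_true] at h
  obtain ⟨⟨n₄₁, n₄₂⟩, h⟩ := h
  obtain ⟨x₆, h₆, h⟩ := anyBit_eq_true h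
  simp only [Bool.and_eq_true] at h
  obtain ⟨⟨⟨n₆₂, n₆₃⟩, n₆₄⟩, h⟩ := h
  obtain ⟨v, hv, h⟩ := anyBit_eq_true h
  simp only [Bool.and_eq_true] at h
  obtain ⟨⟨nv₁, nv₃⟩, nv₅⟩ := h
  have n₂₅ := ne_of_not_beq n₂₅
  have n₄₁ := ne_of_not_beq n₄₁
  have n₄₂ := ne_of_not_beq n₄₂
  have n₆₂ := ne_of_not_beq n₆₂
  have n₆₃ := ne_of_not_beq n₆₃
  have n₆₄ := ne_of_not_beq n₆₄
  have nv₁ := ne_of_not_beq nv₁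
  have nv₃ := ne_of_not_beq nv₃
  have nv₅ := ne_of_not_beq nv₅
  have h₁₃ := adj_of_upper hP h₁₃
  have h₅₁ := (adj_of_upper hP (testBit_land h₅).1).symm
  have h₃₅ := adj_of_upper hP (testBit_land h₅).2
  have h₁₂ := adj_of_nbrs hP (testBit_land h₂).1
  have h₂₃ := (adj_of_nbrs hP (testBit_land h₂).2).symm
  have h₃₄ := adj_of_nbrs hP (testBit_land h₄).1
  have h₄₅ := (adj_of_nbrs hP (testBit_land h₄).2).symm
  have h₅₆ := adj_of_nbrs hP (testBit_land h₆).1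
  have h₆₁ := (adj_of_nbrs hP (testBit_land h₆).2).symm
  have hv₂ := (adj_of_nbrs hP (testBit_land (testBit_land hv).1).1).symm
  have hv₄ := (adj_of_nbrs hP (testBit_land (testBit_land hv).1).2).symm
  have hv₆ := (adj_of_nbrs hP (testBit_land hv).2).symm
  refine isContained_fromRel (φ := ![x₁, x₂, x₃, x₄, x₅, x₆, v]) ?_ fun i j hij => ?_
  · rw [← List.nodup_ofFn]
    simp [h₁₃.ne, h₅₁.ne', h₃₅.ne, h₁₂.ne, h₂₃.ne, h₃₄.ne, h₄₅.ne, h₅₆.ne, h₆₁.ne', hv₂.ne',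
      hv₄.ne', hv₆.ne', n₂₅, n₄₁.symm, n₄₂.symm, n₆₂.symm, n₆₃.symm, n₆₄.symm, nv₁.symm, nv₃.symm,
      nv₅.symm]
  · fin_cases i <;> fin_cases j <;> first | assumption | simp at hij

end Copies

/-- The graph `G` contains one of `K_4`, `K_1 + C_5`, `H_7` and `M_7`. -/
def ContainsCritical {V : Type*} (G : SimpleGraph V) : Prop :=
  (⊤ : SimpleGraph (Fin 4)).IsContained G ∨
    (graphJoin (⊤ : SimpleGraph (Fin 1)) (cyc 5)).IsContained G ∨
    H7.IsContained G ∨ M7.IsContained G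

theorem containsCritical_of_checkPattern {G : SimpleGraph (Fin 7)} {p : Fin 7 → Fin 4} {P : ℕ}
    (h : checkPattern p P = true) (hP : ∀ i, P.testBit i = true → i ∈ codes G)
    (hp : ∀ i j, G.Adj i j → p i ≠ p j) (hG : ¬ G.Colorable 3) : ContainsCritical G := by
  obtain ⟨Q, hQ, hQG⟩ := exists_of_checkTransversals h hP (by simp) fun c hc => by
    simp only [monoClauses, List.mem_flatMap, List.mem_filter, List.mem_map] at hc
    obtain ⟨-, -, ⟨⟨k, -, rfl⟩, -⟩, -⟩ := hc
    exact exists_mem_monoPairs hp hG _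
  simp only [hasCritical, Bool.or_eq_true] at hQ
  obtain ((h | h) | h) | h := hQ
  · exact .inl (isContained_of_hasK4 hQG h)
  · exact .inr (.inl (isContained_of_hasW5 hQG h))
  · exact .inr (.inr (.inl (isContained_of_hasH7 hQG h)))
  · exact .inr (.inr (.inr (isContained_of_hasM7 hQG h)))

theorem codes_of_star {G : SimpleGraph (Fin 7)} {a b c : Fin 7} (ha : G.Adj a 6) (hb : G.Adj b 6)
    (hc : G.Adj c 6) (i : ℕ) (hi : (star a b c).testBit i = true) : i ∈ codes G := by
  have key : ∀ a : Fin 7, G.Adj a 6 → 7 * (a : ℕ) + 6 ∈ codes G := by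
    intro a ha
    have h₁ : (7 * (a : ℕ) + 6) / 7 = a := by omega
    have h₂ : (7 * (a : ℕ) + 6) % 7 = 6 := by omega
    simpa [codes, h₁, h₂] using ha
  have hi' : (pairMask (7 * a + 6) ||| (pairMask (7 * b + 6) ||| pairMask (7 * c + 6))).testBit i
      = true := hi
  simp only [Nat.testBit_or, Bool.or_eq_true] at hi'
  obtain h | h | h := hi'
  · exact (codes_of_pairMask h).2 (key a ha)
  · exact (codes_of_pairMask h).2 (key b hb)
  · exact (codes_of_pairMask h).2 (key c hc)

theorem IsContained.of_map {V W U : Type*} {G : SimpleGraph V} {H : SimpleGraph U} {f : V ↪ W}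
    (h : H.IsContained (G.map f)) (hH : ∀ i, ∃ j, H.Adj i j) : H.IsContained G := by
  obtain ⟨φ⟩ := h
  have hφ : ∀ i, ∃ x, f x = φ i := fun i => by
    obtain ⟨j, hij⟩ := hH i
    obtain ⟨x, -, -, hx, -⟩ := (SimpleGraph.map_adj _ _ _ _).1 (φ.toHom.map_adj hij)
    exact ⟨x, hx⟩
  choose g hg using hφ
  refine ⟨⟨⟨g, fun {i j} hij => ?_⟩, fun i j hij => φ.injective ?_⟩⟩
  · have h : (G.map f).Adj (φ i) (φ j) := φ.toHom.map_adj hij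
    rwa [← hg i, ← hg j, SimpleGraph.map_adj_apply] at h
  · change φ i = φ j
    rw [← hg i, ← hg j]
    exact congrArg f hij

theorem ContainsCritical.of_map {V W : Type*} {G : SimpleGraph V} {f : V ↪ W}
    (h : ContainsCritical (G.map f)) : ContainsCritical G := by
  refine h.imp (fun h => IsContained.of_map h ?_) (Or.imp (fun h => IsContained.of_map h ?_)
    (Or.imp (fun h => IsContained.of_map h ?_) (fun h => IsContained.of_map h ?_)))
  · exact fun i => ⟨i + 1, by simp⟩
  · rintro (i | i)
    · exact ⟨.inr 0, by simp [graphJoin]⟩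
    · exact ⟨.inl 0, by simp [graphJoin]⟩
  · exact fun i => ⟨![1, 0, 0, 1, 0, 0, 3] i, by fin_cases i <;> simp [H7]⟩
  · exact fun i => ⟨![1, 0, 1, 2, 3, 0, 1] i, by fin_cases i <;> simp [M7]⟩

/-- A map between types fibered over `κ` with small enough fibers in the domain lifts to an
embedding, which may be prescribed at one point of each fiber. -/
theorem exists_embedding_of_card_fiber_le {α β κ : Type*} [Fintype α] [Fintype β] [DecidableEq κ]
    {f : α → κ} {g : β → κ} (hcard : ∀ k, Fintype.card {x // f x = k} ≤ Fintype.card {y // g y = k})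
    {a : κ → α} (ha : ∀ k, f (a k) = k) {b : κ → β} (hb : ∀ k, g (b k) = k) :
    ∃ φ : α ↪ β, (∀ x, g (φ x) = f x) ∧ ∀ k, φ (a k) = b k := by
  classical
  have he : ∀ k, ∃ e : {x // f x = k} ↪ {y // g y = k}, e ⟨a k, ha k⟩ = ⟨b k, hb k⟩ := fun k => by
    obtain ⟨e⟩ := Function.Embedding.nonempty_of_card_le (hcard k)
    exact ⟨e.trans (Equiv.swap (e ⟨a k, ha k⟩) ⟨b k, hb k⟩).toEmbedding, by simp⟩
  choose e he using he
  have key : ∀ {k x} (hx : f x = k), (e (f x) ⟨x, rfl⟩ : β) = e k ⟨x, hx⟩ := by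
    rintro _ x rfl
    rfl
  have hg : ∀ x, g (e (f x) ⟨x, rfl⟩) = f x := fun x => (e (f x) ⟨x, rfl⟩).2
  refine ⟨⟨fun x => e (f x) ⟨x, rfl⟩, fun x y hxy => ?_⟩, hg, fun k => ?_⟩
  · have hf : f x = f y := by
      rw [← hg x, ← hg y]
      exact congrArg g hxy
    have h := hxy
    simp only [key hf] at h
    simpa using (e (f y)).injective (Subtype.ext h)
  · change (e (f (a k)) ⟨a k, rfl⟩ : β) = b k
    rw [key (ha k), he]

theorem containsCritical_of_card_fiber_le {V : Type*} [Fintype V] {G : SimpleGraph V}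
    (hG : ¬ G.Colorable 3) {q : V → Fin 4} (hq : ∀ x y, G.Adj x y → q x ≠ q y)
    {a : Fin 4 → V} (ha : ∀ k, q (a k) = k) (hadj : ∀ k, k ≠ 3 → G.Adj (a k) (a 3))
    {p : Fin 7 → Fin 4} {b : Fin 4 → Fin 7} (hb : ∀ k, p (b k) = k) (hb3 : b 3 = 6)
    (hcard : ∀ k, Fintype.card {x // q x = k} ≤ Fintype.card {y // p y = k})
    (hcheck : checkPattern p (star (b 0) (b 1) (b 2)) = true) : ContainsCritical G := by
  obtain ⟨φ, hφ, hφa⟩ := exists_embedding_of_card_fiber_le hcard ha hb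
  have hstar : ∀ k, k ≠ 3 → (G.map φ).Adj (b k) 6 := fun k hk => by
    rw [← hb3, ← hφa, ← hφa, SimpleGraph.map_adj_apply]
    exact hadj k hk
  refine ContainsCritical.of_map (f := φ) (containsCritical_of_checkPattern hcheck
    (codes_of_star (hstar 0 (by decide)) (hstar 1 (by decide)) (hstar 2 (by decide))) ?_ ?_)
  · intro i j hij
    obtain ⟨x, y, hxy, rfl, rfl⟩ := (SimpleGraph.map_adj _ _ _ _).1 hij
    rw [hφ, hφ]
    exact hq x y hxy
  · exact fun h => hG (h.of_hom (SimpleGraph.Embedding.map φ G).toHom)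

theorem IsCritical.exists_coloring_of_ne {V : Type*} {G : SimpleGraph V} (hG : IsCritical 4 G)
    (v : V) : ∃ c : V → Fin 3, ∀ x y, x ≠ v → y ≠ v → G.Adj x y → c x ≠ c y := by
  classical
  obtain ⟨C⟩ := hG.2 ((⊤ : G.Subgraph).deleteVerts {v}) fun h => by
    have hv : v ∈ ((⊤ : G.Subgraph).deleteVerts {v}).verts := by
      rw [h]
      exact Set.mem_univ v
    simp at hv
  refine ⟨fun x => if hx : x ≠ v then C ⟨x, by simpa using hx⟩ else 0, fun x y hx hy hxy => ?_⟩
  simp only [hx, hy, ne_eq, not_false_eq_true, dite_true]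
  exact C.valid (by simpa [hx, hy] using hxy)

theorem exists_adj_of_not_colorable {V : Type*} {G : SimpleGraph V} {n : ℕ}
    (hG : ¬ G.Colorable n) {v : V} {c : V → Fin n}
    (hc : ∀ x y, x ≠ v → y ≠ v → G.Adj x y → c x ≠ c y) (k : Fin n) :
    ∃ x, G.Adj x v ∧ c x = k := by
  classical
  by_contra! h
  refine hG ⟨SimpleGraph.Coloring.mk (Function.update c v k) fun {x y} hxy => ?_⟩
  by_cases hx : x = v
  · subst hx
    rw [Function.update_self, Function.update_of_ne hxy.ne']
    exact (h y hxy.symm).symm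
  · rw [Function.update_of_ne hx]
    by_cases hy : y = v
    · subst hy
      rw [Function.update_self]
      exact h x hxy
    · rw [Function.update_of_ne hy]
      exact hc x y hx hy hxy

theorem containsCritical_of_monotone {V : Type*} [Fintype V] {G : SimpleGraph V}
    (hG : ¬ G.Colorable 3) (hV : Fintype.card V ≤ 7) {v : V} {c : V → Fin 3}
    (hc : ∀ x y, x ≠ v → y ≠ v → G.Adj x y → c x ≠ c y)
    (hmono : Monotone fun k => Nat.card {x // x ≠ v ∧ c x = k}) : ContainsCritical G := by
  classical
  choose a hav hac using exists_adj_of_not_colorable hG hc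
  let q : V → Fin 4 := fun x => if x = v then 3 else (c x).castSucc
  have hqv : q v = 3 := if_pos rfl
  have hqc : ∀ x, x ≠ v → q x = (c x).castSucc := fun x hx => if_neg hx
  have hq : ∀ x y, G.Adj x y → q x ≠ q y := fun x y hxy => by
    by_cases hx : x = v
    · subst hx
      rw [hqv, hqc y hxy.ne']
      exact (Fin.castSucc_lt_last _).ne'
    · by_cases hy : y = v
      · subst hy
        rw [hqv, hqc x hx]
        exact (Fin.castSucc_lt_last _).ne
      · rw [hqc x hx, hqc y hy]
        exact fun h => hc x y hx hy hxy (Fin.castSucc_injective _ h)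
  have hcard (k : Fin 3) : Fintype.card {x // q x = k.castSucc} =
      Nat.card {x // x ≠ v ∧ c x = k} := by
    rw [Nat.card_eq_fintype_card]
    refine Fintype.card_congr (Equiv.subtypeEquivRight fun x => ?_)
    by_cases hx : x = v
    · subst hx
      simpa [hqv] using (Fin.castSucc_lt_last k).ne'
    · simp [hqc x hx, hx]
  have hcard_v : Fintype.card {x // q x = 3} = 1 := by
    rw [Fintype.card_eq_one_iff]
    refine ⟨⟨v, hqv⟩, fun ⟨x, hx⟩ => Subtype.ext ?_⟩
    by_contra hxv
    rw [hqc x hxv] at hx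
    exact (Fin.castSucc_lt_last _).ne hx
  have hsum : Fintype.card V = ∑ k, Fintype.card {x // q x = k} := by
    rw [← Fintype.card_sigma]
    exact Fintype.card_congr (Equiv.sigmaFiberEquiv q).symm
  rw [Fin.sum_univ_four, hcard_v] at hsum
  have h₀₁ : Fintype.card {x // q x = 0} ≤ Fintype.card {x // q x = 1} :=
    (hcard 0).trans_le ((hmono (by decide : (0 : Fin 3) ≤ 1)).trans_eq (hcard 1).symm)
  have h₁₂ : Fintype.card {x // q x = 1} ≤ Fintype.card {x // q x = 2} :=
    (hcard 1).trans_le ((hmono (by decide : (1 : Fin 3) ≤ 2)).trans_eq (hcard 2).symm)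
  have hqa (k : Fin 3) : q (a k) = k.castSucc := by rw [hqc _ (hav k).ne, hac]
  have h₀ : 0 < Fintype.card {x // q x = 0} := Fintype.card_pos_iff.2 ⟨⟨a 0, hqa 0⟩⟩
  have ha : ∀ k, q (![a 0, a 1, a 2, v] k) = k := by
    intro k
    fin_cases k
    exacts [hqa 0, hqa 1, hqa 2, hqv]
  have hadj : ∀ k, k ≠ 3 → G.Adj (![a 0, a 1, a 2, v] k) v := by
    intro k hk
    fin_cases k
    exacts [hav 0, hav 1, hav 2, absurd rfl hk]
  have key (p : Fin 7 → Fin 4) (n₀ n₁ n₂ : ℕ) (hp : ∀ k, Fintype.card {y // p y = k} =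
      ![n₀, n₁, n₂, 1] k) (h₀ : Fintype.card {x // q x = 0} ≤ n₀)
      (h₁ : Fintype.card {x // q x = 1} ≤ n₁) (h₂ : Fintype.card {x // q x = 2} ≤ n₂) :
      ∀ k, Fintype.card {x // q x = k} ≤ Fintype.card {y // p y = k} := by
    intro k
    rw [hp]
    fin_cases k
    exacts [h₀, h₁, h₂, hcard_v.le]
  obtain h | h | h : Fintype.card {x // q x = 2} ≤ 2 ∨
      (Fintype.card {x // q x = 0} ≤ 1 ∧ Fintype.card {x // q x = 1} ≤ 2 ∧
        Fintype.card {x // q x = 2} ≤ 3) ∨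
      (Fintype.card {x // q x = 0} ≤ 1 ∧ Fintype.card {x // q x = 1} ≤ 1 ∧
        Fintype.card {x // q x = 2} ≤ 4) := by omega
  · exact containsCritical_of_card_fiber_le hG hq ha hadj (b := ![5, 3, 1, 6]) (by decide) rfl
      (key _ 2 2 2 (by decide) (by omega) (by omega) h) checkPattern_222
  · exact containsCritical_of_card_fiber_le hG hq ha hadj (b := ![5, 4, 2, 6]) (by decide) rfl
      (key _ 1 2 3 (by decide) h.1 h.2.1 h.2.2) checkPattern_123
  · exact containsCritical_of_card_fiber_le hG hq ha hadj (b := ![5, 4, 3, 6]) (by decide) rfl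
      (key _ 1 1 4 (by decide) h.1 h.2.1 h.2.2) checkPattern_114

theorem IsCritical.containsCritical {V : Type*} [Fintype V] {G : SimpleGraph V}
    (hG : IsCritical 4 G) (hV : Fintype.card V ≤ 7) : ContainsCritical G := by
  obtain ⟨v⟩ : Nonempty V := by
    by_contra h
    rw [not_nonempty_iff] at h
    exact hG.1 (SimpleGraph.Colorable.of_isEmpty 3)
  obtain ⟨c, hc⟩ := hG.exists_coloring_of_ne v
  let σ := Tuple.sort fun k => Nat.card {x // x ≠ v ∧ c x = k}
  refine containsCritical_of_monotone hG.1 hV (v := v) (c := fun x => σ.symm (c x))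
    (fun x y hx hy hxy h => hc x y hx hy hxy (σ.symm.injective h)) ?_
  have h : Monotone ((fun k => Nat.card {x // x ≠ v ∧ c x = k}) ∘ σ) := Tuple.monotone_sort _
  simpa only [Equiv.symm_apply_eq, Function.comp_def] using h

theorem not_colorable_K4 : ¬ (⊤ : SimpleGraph (Fin 4)).Colorable 3 := fun h => by
  have := h.card_le_of_pairwise_adj (f := id) (fun _ _ h => h)
  simp at this

theorem not_colorable_W5 :
    ¬ (graphJoin (⊤ : SimpleGraph (Fin 1)) (cyc 5)).Colorable 3 := by
  rintro ⟨C⟩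
  have hz (i : ZMod 5) : C (.inl 0) ≠ C (.inr i) := C.valid (by simp [graphJoin])
  have hc (i : ZMod 5) : C (.inr (i + 1)) ≠ C (.inr i) :=
    C.valid (by simp [graphJoin, cyc, (by decide : (1 : ZMod 5) ≠ 0)])
  have key : ∀ z a : Fin 3, z ≠ a → ∀ b, z ≠ b → b ≠ a → ∀ c, z ≠ c → c ≠ b → ∀ d, z ≠ d →
      d ≠ c → ∀ e, z ≠ e → e ≠ d → a ≠ e → False := by decide
  exact key _ _ (hz 0) _ (hz 1) (hc 0) _ (hz 2) (hc 1) _ (hz 3) (hc 2) _ (hz 4) (hc 3) (hc 4)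

theorem not_colorable_H7 : ¬ H7.Colorable 3 := by
  rintro ⟨C⟩
  have hC (i j : Fin 7) (h : H7.Adj i j) : C i ≠ C j := C.valid h
  have key : ∀ z a : Fin 3, z ≠ a → ∀ a₂, z ≠ a₂ → a ≠ a₂ → ∀ b, a ≠ b → a₂ ≠ b → ∀ c, z ≠ c →
      ∀ c₂, z ≠ c₂ → c ≠ c₂ → ∀ d, c ≠ d → c₂ ≠ d → b ≠ d → False := by decide
  apply key (C 0) (C 1) _ (C 2) _ _ (C 3) _ _ (C 4) _ (C 5) _ _ (C 6) <;>
    exact hC _ _ (by simp [H7])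

theorem not_colorable_M7 : ¬ M7.Colorable 3 := by
  rintro ⟨C⟩
  have hC (i j : Fin 7) (h : M7.Adj i j) : C i ≠ C j := C.valid h
  have key : ∀ x₁ x₃ : Fin 3, x₁ ≠ x₃ → ∀ x₅, x₃ ≠ x₅ → x₅ ≠ x₁ → ∀ x₂, x₁ ≠ x₂ → x₂ ≠ x₃ →
      ∀ x₄, x₃ ≠ x₄ → x₄ ≠ x₅ → ∀ x₆, x₅ ≠ x₆ → x₆ ≠ x₁ → ∀ v, v ≠ x₂ → v ≠ x₄ → v ≠ x₆ →
      False := by decide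
  apply key (C 0) (C 2) _ (C 4) _ _ (C 1) _ _ (C 3) _ _ (C 5) _ _ (C 6) <;>
    exact hC _ _ (by simp [M7])

theorem IsCritical.nonempty_iso {V U : Type*} {G : SimpleGraph V} {H : SimpleGraph U} {t : ℕ}
    (hG : IsCritical t G) (hH : ¬ H.Colorable (t - 1)) (h : H.IsContained G) :
    Nonempty (G ≃g H) := by
  obtain ⟨f⟩ := h
  have hf : f.toSubgraph = ⊤ := by
    by_contra hne
    exact hH ((hG.2 _ hne).of_hom f.isoToSubgraph.toHom)
  have e := f.isoToSubgraph
  rw [hf] at e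
  exact ⟨(e.trans SimpleGraph.Subgraph.topIso).symm⟩

/-- Every 4-critical graph with at most seven vertices is isomorphic to `K_4`,
`K_1 + C_5`, `H_7`, or `M_7`. -/
theorem four_critical_at_most_seven_vertices {V : Type} [Fintype V] (G : SimpleGraph V)
    (hG : IsCritical 4 G) (hcard : Fintype.card V ≤ 7) :
    Nonempty (G ≃g (⊤ : SimpleGraph (Fin 4))) ∨
    Nonempty (G ≃g graphJoin (⊤ : SimpleGraph (Fin 1)) (cyc 5)) ∨
    Nonempty (G ≃g H7) ∨
    Nonempty (G ≃g M7) :=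
  (hG.containsCritical hcard).imp (hG.nonempty_iso not_colorable_K4)
    (Or.imp (hG.nonempty_iso not_colorable_W5)
      (Or.imp (hG.nonempty_iso not_colorable_H7) (hG.nonempty_iso not_colorable_M7)))
end
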